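/- For all real numbers d_i > 1, c_i > 0, d_u > 1, c_u > 0 and every χ > 0 there exists p_* < 1 (depending only on d_i, c_i, d_u, c_u, χ) such that: for every infinite, connected, locally finite graph G = (V,E) satisfying the local isoperimetric inequality L(d_i,c_i) and the volume upper bound V_u(d_u,c_u), and for every p with p_* < p ≤ 1, one has lim_{n→∞} n^χ · sup_{x ∈ V} P_p[ n < |C_x| < ∞ ] = 0, where C_x denotes the open cluster containing x. -/

import Mathlib

open MeasureTheory Filter

universe u

variable {V : Type u}

/-- The set of vertices within graph distance `r` of `x`. -/
def gball (G : SimpleGraph V) (x : V) (r : ℝ) : Set V :=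
  {y | ∃ p : G.Walk x y, (p.length : ℝ) ≤ r}

/-- The `r`-neighborhood `B(K, r)` of a set `K`. -/
def gnbhd (G : SimpleGraph V) (K : Set V) (r : ℝ) : Set V :=
  {y | ∃ x ∈ K, y ∈ gball G x r}

/-- The edge boundary of `A` relative to `B`, encoded as ordered pairs
`(a, b)` with `a ∈ A`, `b ∈ B \ A` and `a ~ b`. -/
def relBoundary (G : SimpleGraph V) (A B : Set V) : Set (V × V) :=
  {e | G.Adj e.1 e.2 ∧ e.1 ∈ A ∧ e.2 ∈ B ∧ e.2 ∉ A}

/-- The edge boundary of `A`, encoded as ordered pairs `(a, b)` with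
`a ∈ A`, `b ∉ A` and `a ~ b`. -/
def bdry (G : SimpleGraph V) (A : Set V) : Set (V × V) :=
  {e | G.Adj e.1 e.2 ∧ e.1 ∈ A ∧ e.2 ∉ A}

/-- The local isoperimetric inequality `L(dᵢ, cᵢ)`. -/
def LocalIso (G : SimpleGraph V) (di ci : ℝ) : Prop :=
  ∀ (x : V) (r : ℝ), 1 ≤ r → ∀ A : Set V, A ⊆ gball G x r →
    (A.ncard : ℝ) ≤ (gball G x r).ncard / 2 →
    ci * (A.ncard : ℝ) ^ ((di - 1) / di) ≤ ((relBoundary G A (gball G x r)).ncard : ℝ)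

/-- The volume upper bound `𝒱ᵤ(dᵤ, cᵤ)`. -/
def VolUpper (G : SimpleGraph V) (du cu : ℝ) : Prop :=
  ∀ (x : V) (r : ℝ), 1 ≤ r →
    (gball G x r).Finite ∧ ((gball G x r).ncard : ℝ) ≤ cu * r ^ du

/-- The volume lower bound `𝒱ₗ(dₗ, cₗ)`. -/
def VolLower (G : SimpleGraph V) (dl cl : ℝ) : Prop :=
  ∀ (x : V) (r : ℝ), 1 ≤ r → cl * r ^ dl ≤ ((gball G x r).ncard : ℝ)

/-- Every walk from `y` to `z` has length at least `t`; equivalently the graph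
distance from `y` to `z` (with value `∞` if unreachable) is at least `t`. -/
def distGE (G : SimpleGraph V) (y z : V) (t : ℝ) : Prop :=
  ∀ p : G.Walk y z, t ≤ (p.length : ℝ)

/-- The distance between the sets `A` and `B` is at least `t`. -/
def setDistGE (G : SimpleGraph V) (A B : Set V) (t : ℝ) : Prop :=
  ∀ a ∈ A, ∀ b ∈ B, distGE G a b t

/-- The diameter of `A` is at least `t`. -/
def diamGE (G : SimpleGraph V) (A : Set V) (t : ℝ) : Prop :=
  ∃ y ∈ A, ∃ z ∈ A, distGE G y z t

/-- The diameter of `A` is at most `t`. -/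
def diamLE (G : SimpleGraph V) (A : Set V) (t : ℝ) : Prop :=
  ∀ y ∈ A, ∀ z ∈ A, ∃ p : G.Walk y z, (p.length : ℝ) ≤ t

/-- `A` is a connected set of vertices. -/
def ConnSet (G : SimpleGraph V) (A : Set V) : Prop := (G.induce A).Connected

/-- There is an open path, all of whose vertices lie in `S`, connecting `A` to `A'`:
its first vertex lies in `B(A,1)` and its last vertex in `B(A',1)`. -/
def ConnectsIn (G : SimpleGraph V) (ω : V → Bool) (A A' S : Set V) : Prop :=
  ∃ (a b : V) (p : G.Walk a b), a ∈ gnbhd G A 1 ∧ b ∈ gnbhd G A' 1 ∧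
    (∀ v ∈ p.support, v ∈ S) ∧ (∀ v ∈ p.support, ω v = true)

/-- The separation event `𝒮(x, L)`. -/
def sep (G : SimpleGraph V) (ω : V → Bool) (x : V) (L : ℝ) : Prop :=
  ∃ A B : Set V, A ⊆ gball G x (3 * L / 6) ∧ B ⊆ gball G x (3 * L / 6) ∧
    ConnSet G A ∧ ConnSet G B ∧ setDistGE G A B 2 ∧
    diamGE G A (L / 100) ∧ diamGE G B (L / 100) ∧
    ¬ ConnectsIn G ω A B (gball G x L)

/-- The open cluster `𝒞ₓ` of `x` (empty when `x` is closed). -/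
def openCluster (G : SimpleGraph V) (ω : V → Bool) (x : V) : Set V :=
  {y | ω x = true ∧ ∃ p : G.Walk x y, ∀ v ∈ p.support, ω v = true}

/-- There is exactly one infinite open cluster. -/
def UniqueInfCluster (G : SimpleGraph V) (ω : V → Bool) : Prop :=
  (∃ x, (openCluster G ω x).Infinite) ∧
    ∀ x y, (openCluster G ω x).Infinite → (openCluster G ω y).Infinite →
      openCluster G ω x = openCluster G ω y

/-- `P` is the Bernoulli product measure on `{0,1}^V` with parameter `p`, characterized by
its values on cylinder events. -/
def IsBernoulli (P : Measure (V → Bool)) (p : ℝ) : Prop :=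
  ∀ (F : Finset V) (η : V → Bool),
    P {ω | ∀ x ∈ F, ω x = η x} =
      ENNReal.ofReal (p ^ (F.filter fun x => η x = true).card *
        (1 - p) ^ (F.filter fun x => η x = false).card)

/-- A decreasing event. -/
def DecreasingEvent (E : Set (V → Bool)) : Prop :=
  ∀ ω ∈ E, ∀ ω' : V → Bool, (∀ x, ω' x ≤ ω x) → ω' ∈ E

/-- The σ-algebra `σ(Y_z ; z ∈ S)` generated by the coordinates in `S`. -/
def cylσ (S : Set V) : MeasurableSpace (V → Bool) :=
  MeasurableSpace.comap (fun ω => S.restrict ω) MeasurableSpace.pi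

/-- The decoupling inequality `𝒟(α, c_α)`. -/
def Decoupling (G : SimpleGraph V) (P : Measure (V → Bool)) (α cα : ℝ) : Prop :=
  ∀ (x : V) (r : ℝ), 1 ≤ r → ∀ E E' : Set (V → Bool),
    DecreasingEvent E → DecreasingEvent E' →
    MeasurableSet[cylσ (gball G x r)] E →
    MeasurableSet[cylσ (gball G x (2 * r))ᶜ] E' →
    P (E ∩ E') ≤ P E * P E' + ENNReal.ofReal (cα * r ^ (-α))

/-- The scales `L₀ = 10000`, `L_{k+1} = L_k ^ γ`. -/
noncomputable def Lseq (γ : ℝ) : ℕ → ℝ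
  | 0 => 10000
  | k + 1 => Lseq γ k ^ γ

/-! ### Reachability inside a set -/

def Rch (G : SimpleGraph V) (S : Set V) (a b : V) : Prop :=
  ∃ p : G.Walk a b, ∀ v ∈ p.support, v ∈ S

lemma Rch.refl {G : SimpleGraph V} {S : Set V} {a : V} (h : a ∈ S) : Rch G S a a :=
  ⟨SimpleGraph.Walk.nil, by simpa using h⟩

lemma Rch.symm {G : SimpleGraph V} {S : Set V} {a b : V} (h : Rch G S a b) : Rch G S b a := by
  obtain ⟨p, hp⟩ := h
  exact ⟨p.reverse, by simpa using hp⟩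

lemma Rch.trans {G : SimpleGraph V} {S : Set V} {a b c : V} (h : Rch G S a b)
    (h' : Rch G S b c) : Rch G S a c := by
  obtain ⟨p, hp⟩ := h
  obtain ⟨q, hq⟩ := h'
  refine ⟨p.append q, fun v hv => ?_⟩
  rw [SimpleGraph.Walk.mem_support_append_iff] at hv
  exact hv.elim (hp v) (hq v)

lemma Rch.adj {G : SimpleGraph V} {S : Set V} {a b : V} (h : G.Adj a b) (ha : a ∈ S)
    (hb : b ∈ S) : Rch G S a b :=
  ⟨SimpleGraph.Walk.cons h SimpleGraph.Walk.nil, by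
    intro v hv
    simp at hv
    rcases hv with rfl | rfl <;> assumption⟩

lemma Rch.left {G : SimpleGraph V} {S : Set V} {a b : V} (h : Rch G S a b) : a ∈ S := by
  obtain ⟨p, hp⟩ := h
  exact hp a p.start_mem_support

lemma Rch.right {G : SimpleGraph V} {S : Set V} {a b : V} (h : Rch G S a b) : b ∈ S := by
  obtain ⟨p, hp⟩ := h
  exact hp b p.end_mem_support

lemma Rch.mono {G : SimpleGraph V} {S T : Set V} {a b : V} (h : Rch G S a b)
    (hT : ∀ z, Rch G S a z → z ∈ T) : Rch G T a b := by
  classical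
  obtain ⟨p, hp⟩ := h
  refine ⟨p, fun v hv => hT v ⟨p.takeUntil v hv, fun w hw => ?_⟩⟩
  exact hp w (p.support_takeUntil_subset_support hv hw)

lemma Rch.ivt {G : SimpleGraph V} (hG : G.Connected) {S : Set V} {u a b : V}
    (h : Rch G S a b) (j : ℕ) (h1 : G.dist u a ≤ j) (h2 : j ≤ G.dist u b) :
    ∃ v ∈ S, G.dist u v = j := by
  obtain ⟨p, hp⟩ := h
  induction p with
  | nil => exact ⟨_, hp _ (by simp), le_antisymm h1 h2⟩
  | @cons a a' b hadj p ih =>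
    rcases h1.eq_or_lt with h | h
    · exact ⟨a, hp _ (by simp), h⟩
    · refine ih ?_ h2 (fun v hv => hp v (by simp [hv]))
      have := hG.dist_triangle (u := u) (v := a) (w := a')
      have h3 : G.dist a a' = 1 := SimpleGraph.dist_eq_one_iff_adj.2 hadj
      omega

lemma Rch.card {G : SimpleGraph V} (hG : G.Connected) {S : Set V} {u b : V}
    (h : Rch G S u b) (r : ℕ) (hr : r ≤ G.dist u b)
    (hfin : {y | G.dist u y ≤ r}.Finite) :
    r + 1 ≤ (S ∩ {y | G.dist u y ≤ r}).ncard := by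
  have hf : (S ∩ {y | G.dist u y ≤ r}).Finite := hfin.subset Set.inter_subset_right
  have hsub : (Finset.range (r + 1) : Set ℕ) ⊆ (fun y => G.dist u y) '' (S ∩ {y | G.dist u y ≤ r}) := by
    intro j hj
    have hj' : j ≤ r := by simpa [Nat.lt_succ_iff] using hj
    obtain ⟨v, hv, hd⟩ := h.ivt hG (u := u) j (by simp) (hj'.trans hr)
    exact ⟨v, ⟨hv, by simp [hd, hj']⟩, hd⟩
  have h1 := Set.ncard_le_ncard hsub (hf.image _)
  rw [Set.ncard_coe_finset, Finset.card_range] at h1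
  exact h1.trans (Set.ncard_image_le hf)

/-! ### Deterministic cluster geometry -/

lemma cluster_geom {G : SimpleGraph V} (hG : G.Connected) (hV : Infinite V)
    (hfin : ∀ (x : V) (r : ℕ), {y | G.dist x y ≤ r}.Finite)
    (O : Set V) (x : V) (hx : x ∈ O) (hC : {y | Rch G O x y}.Finite) (R : ℕ)
    (hR : ∀ v : V, {y | G.dist v y ≤ R}.ncard < {y | Rch G O x y}.ncard) :
    ∃ U : Set V,
      (∀ v ∈ U, ∀ L ≤ R, L + 1 ≤ (U ∩ {y | G.dist v y ≤ L}).ncard) ∧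
      (∀ v ∉ U, ∀ L ≤ R, L + 1 ≤ (Uᶜ ∩ {y | G.dist v y ≤ L}).ncard) ∧
      (∀ v ∈ U, ∀ w ∉ U, G.Adj v w → v ∉ O) ∧
      ∃ v ∈ U, (∃ w ∉ U, G.Adj v w) ∧ G.dist x v ≤ {y | Rch G O x y}.ncard + 1 := by
  classical
  set C : Set V := {y | Rch G O x y} with hCdef
  have hxC : x ∈ C := Rch.refl hx
  let comp : V → Set V := fun v => {y | Rch G Cᶜ v y}
  let U : Set V := {v | v ∉ C ∧ (comp v).Infinite}
  have hUC : ∀ v ∈ U, v ∉ C := fun v hv => hv.1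
  -- stability
  have hstab : ∀ v ∈ U, ∀ z, Rch G Cᶜ v z → z ∈ U := by
    intro v hv z hz
    refine ⟨hz.right, hv.2.mono ?_⟩
    intro y hy
    exact hz.symm.trans hy
  have hadjC : ∀ v ∈ U, ∀ w ∉ U, G.Adj v w → w ∈ C := by
    intro v hv w hw hadj
    by_contra hwC
    exact hw (hstab v hv w (Rch.adj hadj (hUC v hv) hwC))
  have hCU : ∀ y ∈ C, y ∈ Uᶜ := fun y hy hyU => hUC y hyU hy
  have hCC : ∀ y ∈ C, Rch G Uᶜ x y := fun y hy => Rch.mono hy (fun z hz => hCU z hz)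
  have hreach : ∀ (v : V) (p : G.Walk v x), v ∉ U → Rch G Uᶜ v x := by
    intro v p
    have : ∀ (a b : V) (p : G.Walk a b), b = x → a ∉ U → Rch G Uᶜ a x := by
      intro a b p
      induction p with
      | nil =>
        rintro rfl ha
        exact Rch.refl ha
      | @cons a a' b hadj p ih =>
        intro hb ha
        by_cases haC : a ∈ C
        · exact (hCC a haC).symm
        · have ha' : a' ∉ U := fun h => haC (hadjC a' h a ha hadj.symm)
          exact (Rch.adj hadj ha ha').trans (ih hb ha')
    exact this v x p rfl
  refine ⟨U, ?_, ?_, ?_, ?_⟩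
  · intro v hv L hL
    obtain ⟨y, hy, hyL⟩ := hv.2.exists_notMem_finite (hfin v L)
    have hy' : Rch G U v y := Rch.mono hy (hstab v hv)
    exact hy'.card hG L (by simp at hyL; omega) (hfin v L)
  · intro v hv L hL
    obtain ⟨p⟩ := hG.preconnected v x
    have h1 := hreach v p hv
    obtain ⟨y, hy, hyL⟩ : ∃ y ∈ C, y ∉ {y | G.dist v y ≤ R} := by
      by_contra hcon
      push Not at hcon
      exact absurd (Set.ncard_le_ncard (s := C) hcon (hfin v R)) (not_le.2 (hR v))
    exact (h1.trans (hCC y hy)).card hG L (by simp at hyL; omega) (hfin v L)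
  · intro v hv w hw hadj hvO
    have hwC : Rch G O x w := hadjC v hv w hw hadj
    exact hUC v hv (hwC.trans (Rch.adj hadj.symm hwC.right hvO))
  · have hne : ∃ u, u ∈ U := by
      by_contra hcon
      push Not at hcon
      have hcomp : ∀ v, v ∉ C → (comp v).Finite := by
        intro v hv
        by_contra h
        exact hcon v ⟨hv, h⟩
      have hex : ∀ (a b : V) (p : G.Walk a b), b = x → a ∉ C →
          ∃ z, z ∉ C ∧ (∃ w ∈ C, G.Adj w z) ∧ Rch G Cᶜ z a := by
        intro a b p
        induction p with
        | nil =>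
          rintro rfl ha
          exact absurd hxC ha
        | @cons a a' b hadj p ih =>
          intro hb ha
          by_cases h : a' ∈ C
          · exact ⟨a, ha, ⟨a', h, hadj.symm⟩, Rch.refl ha⟩
          · obtain ⟨z, hz, hw, hr⟩ := ih hb h
            exact ⟨z, hz, hw, hr.trans (Rch.adj hadj.symm h ha)⟩
      have hN : (⋃ w ∈ C, {y | G.dist w y ≤ 1}).Finite := hC.biUnion (fun w _ => hfin w 1)
      have hN' : ((⋃ w ∈ C, {y | G.dist w y ≤ 1}) \ C).Finite := hN.subset Set.diff_subset
      have hA : (⋃ z ∈ ((⋃ w ∈ C, {y | G.dist w y ≤ 1}) \ C), comp z).Finite :=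
        hN'.biUnion (fun z hz => hcomp z hz.2)
      have : (Set.univ : Set V).Finite := by
        refine (hC.union hA).subset ?_
        intro a _
        by_cases ha : a ∈ C
        · exact Or.inl ha
        · right
          obtain ⟨p⟩ := hG.preconnected a x
          obtain ⟨z, hz, ⟨w, hw, hwz⟩, hr⟩ := hex a x p rfl ha
          refine Set.mem_biUnion (x := z) ⟨?_, hz⟩ hr
          refine Set.mem_biUnion (x := w) hw ?_
          have : G.dist w z = 1 := SimpleGraph.dist_eq_one_iff_adj.2 hwz
          simp [this]
      exact Set.infinite_univ this
    obtain ⟨u, hu⟩ := hne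
    obtain ⟨p⟩ := hG.preconnected u x
    obtain ⟨e, he, h1, h2⟩ := p.exists_boundary_dart U hu (hCU x hxC)
    refine ⟨e.fst, h1, ⟨e.snd, h2, e.adj⟩, ?_⟩
    have hwC : e.snd ∈ C := hadjC _ h1 _ h2 e.adj
    have hw : Rch G C x e.snd := Rch.mono hwC (fun z hz => hz)
    have h3 := hw.card hG (G.dist x e.snd) le_rfl (hfin _ _)
    have h4 : (C ∩ {y | G.dist x y ≤ G.dist x e.snd}).ncard ≤ C.ncard :=
      Set.ncard_le_ncard Set.inter_subset_left hC
    have h5 := hG.dist_triangle (u := x) (v := e.snd) (w := e.fst)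
    have h6 : G.dist e.snd e.fst = 1 := SimpleGraph.dist_eq_one_iff_adj.2 e.adj.symm
    omega

/-! ### Greedy selection -/

lemma greedy {G : SimpleGraph V} (s M : ℕ) (hM : 1 ≤ M)
    (hfin : ∀ x : V, {y | G.dist x y ≤ s}.Finite)
    (hball : ∀ x : V, {y | G.dist x y ≤ s}.ncard ≤ M) :
    ∀ (m : ℕ) (S : Finset V), m * M ≤ S.card →
      ∃ y : Fin m → V, (∀ i, y i ∈ S) ∧ ∀ i j, i ≠ j → s < G.dist (y i) (y j) := by
  classical
  intro m
  induction m with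
  | zero => intro S _; exact ⟨Fin.elim0, fun i => i.elim0, fun i => i.elim0⟩
  | succ m ih =>
    intro S hS
    have hpos : 0 < S.card := by nlinarith
    obtain ⟨x, hx⟩ := Finset.card_pos.1 hpos
    have h1 : (S.filter (fun y => G.dist x y ≤ s)).card ≤ M := by
      rw [← Set.ncard_coe_finset]
      refine (Set.ncard_le_ncard ?_ (hfin x)).trans (hball x)
      intro y hy
      simp at hy
      exact hy.2
    have h2 := Finset.card_filter_add_card_filter_not (s := S) (fun y => G.dist x y ≤ s)
    obtain ⟨y, hyS, hy⟩ := ih (S.filter (fun y => ¬ G.dist x y ≤ s)) (by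
      rw [add_mul] at hS; omega)
    simp only [Finset.mem_filter, not_le] at hyS
    refine ⟨Fin.cons x y, ?_, ?_⟩
    · intro i
      refine Fin.cases ?_ (fun i => ?_) i
      · simpa using hx
      · simpa using (hyS i).1
    · intro i j
      refine Fin.cases ?_ (fun i => ?_) i
      · refine Fin.cases ?_ (fun j => ?_) j
        · simp
        · intro _; simpa using (hyS j).2
      · refine Fin.cases ?_ (fun j => ?_) j
        · intro _
          simpa [SimpleGraph.dist_comm] using (hyS i).2
        · intro hij
          simpa using hy i j (by simpa using hij)

/-! ### Boundary count -/

lemma boundary_count {G : SimpleGraph V} (hG : G.Connected) (c : ℕ) (ci β : ℝ)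
    (hci : 0 < ci) (hβ : 0 ≤ β)
    (hfin : ∀ (x : V) (r : ℕ), {y | G.dist x y ≤ r}.Finite)
    (hdeg : ∀ x : V, {y | G.dist x y ≤ 1}.ncard ≤ c)
    (U : Set V) (v : V) (L : ℕ)
    (hiso : ∀ A : Set V, A ⊆ {y | G.dist v y ≤ L} →
      2 * A.ncard ≤ {y | G.dist v y ≤ L}.ncard →
      ci * (A.ncard : ℝ) ^ β ≤ ((relBoundary G A {y | G.dist v y ≤ L}).ncard : ℝ))
    (hU : L ≤ (U ∩ {y | G.dist v y ≤ L}).ncard)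
    (hU' : L ≤ (Uᶜ ∩ {y | G.dist v y ≤ L}).ncard) :
    ∃ S : Finset V, (∀ u ∈ S, G.dist v u ≤ L ∧ u ∈ U ∧ ∃ w ∉ U, G.Adj u w) ∧
      ci * (L : ℝ) ^ β ≤ S.card * c := by
  classical
  set B : Set V := {y | G.dist v y ≤ L} with hB
  have hBf : B.Finite := hfin v L
  have hSf : {u | u ∈ B ∧ u ∈ U ∧ ∃ w ∉ U, G.Adj u w}.Finite := hBf.subset (fun u hu => hu.1)
  refine ⟨hSf.toFinset, ?_, ?_⟩
  · intro u hu
    simpa [hB] using hu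
  set S := hSf.toFinset
  let T : Finset (V × V) := S.biUnion (fun u => (hfin u 1).toFinset.image (fun w => (u, w)))
  have hT : T.card ≤ S.card * c := by
    refine Finset.card_biUnion_le_card_mul _ _ _ (fun u _ => ?_)
    refine Finset.card_image_le.trans ?_
    rw [← Set.ncard_eq_toFinset_card _ (hfin u 1)]
    exact hdeg u
  have hTmem : ∀ u w, u ∈ B → u ∈ U → w ∉ U → G.Adj u w → (u, w) ∈ T := by
    intro u w h1 h2 h3 h4
    simp only [T, Finset.mem_biUnion, Finset.mem_image]
    refine ⟨u, ?_, w, ?_, rfl⟩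
    · simp only [S, Set.Finite.mem_toFinset]
      exact ⟨h1, h2, w, h3, h4⟩
    · have : G.dist u w = 1 := SimpleGraph.dist_eq_one_iff_adj.2 h4
      simp [this]
  have hadd : (U ∩ B).ncard + (Uᶜ ∩ B).ncard = B.ncard := by
    rw [← Set.ncard_inter_add_ncard_diff_eq_ncard B U hBf, Set.inter_comm U B]
    congr 2
    ext y; simp [and_comm]
  have key : ∀ A : Set V, A ⊆ B → 2 * A.ncard ≤ B.ncard → L ≤ A.ncard →
      (relBoundary G A B).ncard ≤ T.card → ci * (L : ℝ) ^ β ≤ S.card * c := by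
    intro A h1 h2 h3 h4
    calc ci * (L : ℝ) ^ β ≤ ci * (A.ncard : ℝ) ^ β := by gcongr
      _ ≤ ((relBoundary G A B).ncard : ℝ) := hiso A h1 h2
      _ ≤ ((S.card * c : ℕ) : ℝ) := by exact_mod_cast h4.trans hT
      _ = _ := by push_cast; ring
  rcases le_total (U ∩ B).ncard (Uᶜ ∩ B).ncard with h | h
  · refine key (U ∩ B) Set.inter_subset_right (by omega) hU ?_
    rw [← Set.ncard_coe_finset]
    refine Set.ncard_le_ncard ?_ (Finset.finite_toSet _)
    rintro ⟨a, b⟩ ⟨h1, h2, h3, h4⟩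
    exact hTmem a b h2.2 h2.1 (fun hb => h4 ⟨hb, h3⟩) h1
  · refine key (Uᶜ ∩ B) Set.inter_subset_right (by omega) hU' ?_
    have : T.card = (T.image Prod.swap).card :=
      (Finset.card_image_of_injective _ Prod.swap_injective).symm
    rw [this, ← Set.ncard_coe_finset]
    refine Set.ncard_le_ncard ?_ (Finset.finite_toSet _)
    rintro ⟨a, b⟩ ⟨h1, h2, h3, h4⟩
    rw [Finset.mem_coe, Finset.mem_image]
    refine ⟨(b, a), hTmem b a h3 ?_ h2.1 h1.symm, rfl⟩
    by_contra hb
    exact h4 ⟨hb, h3⟩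

/-! ### Hierarchical bad events -/

def BadAt (G : SimpleGraph V) (Λ g : ℕ) (ω : V → Bool) : ℕ → V → Prop
  | 0, x => ω x = false
  | k + 1, x => ∃ y : Fin (2 * g) → V, (∀ i, G.dist x (y i) ≤ Λ ^ (g ^ (k + 1))) ∧
      (∀ i j, i ≠ j → 4 * Λ ^ (g ^ k) < G.dist (y i) (y j)) ∧ ∀ i, BadAt G Λ g ω k (y i)

lemma bad_of_boundary {G : SimpleGraph V} (hG : G.Connected) (c d Λ g : ℕ) (ci β : ℝ)
    (hc : 1 ≤ c) (hΛ : 1 ≤ Λ) (hci : 0 < ci) (hβ : 0 ≤ β)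
    (hfin : ∀ (x : V) (r : ℕ), {y | G.dist x y ≤ r}.Finite)
    (hvol : ∀ (x : V) (r : ℕ), 1 ≤ r → {y | G.dist x y ≤ r}.ncard ≤ c * r ^ d)
    (hiso : ∀ (v : V) (L : ℕ), 1 ≤ L → ∀ A : Set V, A ⊆ {y | G.dist v y ≤ L} →
      2 * A.ncard ≤ {y | G.dist v y ≤ L}.ncard →
      ci * (A.ncard : ℝ) ^ β ≤ ((relBoundary G A {y | G.dist v y ≤ L}).ncard : ℝ))
    (hscale : ∀ k : ℕ, (2 * g : ℝ) * (c * (4 * (Λ : ℝ) ^ (g ^ k)) ^ d) * c ≤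
      ci * ((Λ ^ (g ^ (k + 1)) : ℕ) : ℝ) ^ β)
    (hmono : ∀ k, Λ ^ (g ^ k) ≤ Λ ^ (g ^ (k + 1)))
    (ω : V → Bool) (U : Set V) (K : ℕ)
    (hU : ∀ v ∈ U, ∀ L ≤ Λ ^ (g ^ K), L + 1 ≤ (U ∩ {y | G.dist v y ≤ L}).ncard)
    (hU' : ∀ v ∉ U, ∀ L ≤ Λ ^ (g ^ K), L + 1 ≤ (Uᶜ ∩ {y | G.dist v y ≤ L}).ncard)
    (hcl : ∀ v ∈ U, ∀ w ∉ U, G.Adj v w → ω v = false) :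
    ∀ k ≤ K, ∀ v ∈ U, (∃ w ∉ U, G.Adj v w) → BadAt G Λ g ω k v := by
  have hmon : Monotone (fun k => Λ ^ (g ^ k)) := monotone_nat_of_le_succ hmono
  intro k
  induction k with
  | zero =>
    rintro _ v hv ⟨w, hw, hadj⟩
    exact hcl v hv w hw hadj
  | succ k ih =>
    rintro hk v hv ⟨w, hw, hadj⟩
    have hLpos : 1 ≤ Λ ^ (g ^ (k + 1)) := Nat.one_le_pow _ _ hΛ
    have hLk : 1 ≤ Λ ^ (g ^ k) := Nat.one_le_pow _ _ hΛ
    have hLK : Λ ^ (g ^ (k + 1)) ≤ Λ ^ (g ^ K) := hmon hk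
    have hb1 : Λ ^ (g ^ (k + 1)) ≤ (U ∩ {y | G.dist v y ≤ Λ ^ (g ^ (k + 1))}).ncard := by
      have := hU v hv _ hLK
      omega
    have hb2 : Λ ^ (g ^ (k + 1)) ≤ (Uᶜ ∩ {y | G.dist v y ≤ Λ ^ (g ^ (k + 1))}).ncard := by
      have h1 := hU' w hw (Λ ^ (g ^ (k + 1)) - 1) (by omega)
      have h2 : (Uᶜ ∩ {y | G.dist w y ≤ Λ ^ (g ^ (k + 1)) - 1}).ncard ≤
          (Uᶜ ∩ {y | G.dist v y ≤ Λ ^ (g ^ (k + 1))}).ncard := by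
        refine Set.ncard_le_ncard ?_ ((hfin _ _).subset Set.inter_subset_right)
        rintro y ⟨hy1, hy2⟩
        refine ⟨hy1, ?_⟩
        have h3 := hG.dist_triangle (u := v) (v := w) (w := y)
        have h4 : G.dist v w = 1 := SimpleGraph.dist_eq_one_iff_adj.2 hadj
        simp only [Set.mem_setOf_eq] at hy2 ⊢
        omega
      omega
    obtain ⟨S, hS, hcard⟩ := boundary_count hG c ci β hci hβ hfin
      (fun x => by simpa using hvol x 1 le_rfl) U v _ (hiso v _ hLpos) hb1 hb2
    have hM : 1 ≤ c * (4 * Λ ^ (g ^ k)) ^ d :=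
      Nat.mul_pos hc (Nat.pow_pos (by omega))
    obtain ⟨y, hyS, hy⟩ := greedy (G := G) (4 * Λ ^ (g ^ k)) (c * (4 * Λ ^ (g ^ k)) ^ d) hM
      (fun x => hfin x _) (fun x => hvol x _ (by omega)) (2 * g) S (by
        have h1 := (hscale k).trans hcard
        have hc' : (0 : ℝ) < c := by exact_mod_cast hc
        have h2 := le_of_mul_le_mul_right h1 hc'
        exact_mod_cast h2)
    refine ⟨y, fun i => (hS _ (hyS i)).1, hy, fun i => ?_⟩
    exact ih (by omega) _ (hS _ (hyS i)).2.1 (hS _ (hyS i)).2.2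

def NN (c d Λ g : ℕ) : ℕ → ℕ
  | 0 => 1
  | k + 1 => (c * (Λ ^ (g ^ (k + 1))) ^ d * NN c d Λ g k) ^ (2 * g)

lemma bad_family {G : SimpleGraph V} (hG : G.Connected) (c d Λ g : ℕ) (hΛ : 1 ≤ Λ)
    (hfin : ∀ (x : V) (r : ℕ), {y | G.dist x y ≤ r}.Finite)
    (hvol : ∀ (x : V) (r : ℕ), 1 ≤ r → {y | G.dist x y ≤ r}.ncard ≤ c * r ^ d)
    (h2 : ∀ k, 2 * Λ ^ (g ^ k) ≤ Λ ^ (g ^ (k + 1))) :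
    ∀ (k : ℕ) (x : V), ∃ F : Finset (Finset V), F.card ≤ NN c d Λ g k ∧
      (∀ f ∈ F, f.card = (2 * g) ^ k ∧ ∀ v ∈ f, G.dist x v ≤ 2 * Λ ^ (g ^ k)) ∧
      ∀ ω, BadAt G Λ g ω k x → ∃ f ∈ F, ∀ v ∈ f, ω v = false := by
  classical
  intro k
  induction k with
  | zero =>
    intro x
    refine ⟨{{x}}, by simp [NN], by simp, ?_⟩
    intro ω hω
    have hω' : ω x = false := hω
    exact ⟨{x}, by simp, by simpa using hω'⟩
  | succ k ih =>
    intro x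
    choose F hF1 hF2 hF3 using ih
    let B : Finset V := (hfin x (Λ ^ (g ^ (k + 1)))).toFinset
    let W : Finset (Finset V) := B.biUnion F
    let H : Finset (Finset V) := (Fintype.piFinset (fun _ : Fin (2 * g) => W)).image
      (fun f => Finset.univ.biUnion f)
    have hB : B.card ≤ c * (Λ ^ (g ^ (k + 1))) ^ d := by
      rw [← Set.ncard_eq_toFinset_card _ (hfin x _)]
      exact hvol x _ (Nat.one_le_pow _ _ hΛ)
    have hW : W.card ≤ c * (Λ ^ (g ^ (k + 1))) ^ d * NN c d Λ g k :=
      (Finset.card_biUnion_le_card_mul _ _ _ (fun y _ => hF1 y)).trans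
        (Nat.mul_le_mul_right _ hB)
    refine ⟨H.filter (fun f => f.card = (2 * g) ^ (k + 1) ∧
      ∀ v ∈ f, G.dist x v ≤ 2 * Λ ^ (g ^ (k + 1))), ?_, ?_, ?_⟩
    · refine (Finset.card_filter_le _ _).trans (Finset.card_image_le.trans ?_)
      rw [Fintype.card_piFinset_const]
      exact Nat.pow_le_pow_left hW _
    · intro f hf
      exact (Finset.mem_filter.1 hf).2
    · rintro ω ⟨y, hy1, hy2, hy3⟩
      choose f hf1 hf2 using fun i => hF3 (y i) ω (hy3 i)
      refine ⟨Finset.univ.biUnion f, ?_, ?_⟩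
      · rw [Finset.mem_filter]
        refine ⟨?_, ?_, ?_⟩
        · refine Finset.mem_image.2 ⟨f, ?_, rfl⟩
          rw [Fintype.mem_piFinset]
          intro i
          refine Finset.mem_biUnion.2 ⟨y i, ?_, hf1 i⟩
          simp only [B, Set.Finite.mem_toFinset]
          exact hy1 i
        · rw [Finset.card_biUnion]
          · rw [Finset.sum_congr rfl (fun i _ => (hF2 _ _ (hf1 i)).1)]
            simp [pow_succ, mul_comm]
          · intro i _ j _ hij
            rw [Function.onFun, Finset.disjoint_left]
            intro v hvi hvj
            have a1 := (hF2 _ _ (hf1 i)).2 v hvi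
            have a2 := (hF2 _ _ (hf1 j)).2 v hvj
            have a3 := hG.dist_triangle (u := y i) (v := v) (w := y j)
            have a4 := hy2 i j hij
            rw [SimpleGraph.dist_comm] at a2
            omega
        · intro v hv
          obtain ⟨i, _, hvi⟩ := Finset.mem_biUnion.1 hv
          have a1 := (hF2 _ _ (hf1 i)).2 v hvi
          have a3 := hG.dist_triangle (u := x) (v := y i) (w := v)
          have a4 := hy1 i
          have a5 := h2 k
          omega
      · intro v hv
        obtain ⟨i, _, hvi⟩ := Finset.mem_biUnion.1 hv
        exact hf2 i v hvi

lemma NN_bound (c d Λ g Q : ℕ) (hQ : ∀ k, c * (Λ ^ (g ^ k)) ^ d ≤ Q ^ (g ^ k)) :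
    ∀ k, NN c d Λ g k * Q ^ (2 * g * g ^ k) ≤ Q ^ (2 * g * (2 * g) ^ k) := by
  intro k
  induction k with
  | zero => simp [NN]
  | succ k ih =>
    have h1 := hQ (k + 1)
    calc NN c d Λ g (k + 1) * Q ^ (2 * g * g ^ (k + 1))
        ≤ (Q ^ (g ^ (k + 1)) * NN c d Λ g k) ^ (2 * g) * Q ^ (2 * g * g ^ (k + 1)) := by
          simp only [NN]
          gcongr
      _ = (NN c d Λ g k * Q ^ (2 * g * g ^ k)) ^ (2 * g) := by
          rw [mul_pow, mul_pow, ← pow_mul, ← pow_mul, mul_comm, ← mul_assoc, ← pow_add,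
            mul_comm]
          congr 2
          ring
      _ ≤ (Q ^ (2 * g * (2 * g) ^ k)) ^ (2 * g) := by gcongr
      _ = _ := by rw [← pow_mul]; congr 1; ring

lemma bad_prob {G : SimpleGraph V} (hG : G.Connected) (c d Λ g : ℕ) (hΛ : 1 ≤ Λ)
    (hfin : ∀ (x : V) (r : ℕ), {y | G.dist x y ≤ r}.Finite)
    (hvol : ∀ (x : V) (r : ℕ), 1 ≤ r → {y | G.dist x y ≤ r}.ncard ≤ c * r ^ d)
    (h2 : ∀ k, 2 * Λ ^ (g ^ k) ≤ Λ ^ (g ^ (k + 1)))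
    (P : Measure (V → Bool)) (p : ℝ) (hP : IsBernoulli P p) (k : ℕ) (x : V) :
    P {ω | BadAt G Λ g ω k x} ≤
      (NN c d Λ g k : ENNReal) * ENNReal.ofReal ((1 - p) ^ ((2 * g) ^ k)) := by
  classical
  obtain ⟨F, hF1, hF2, hF3⟩ := bad_family hG c d Λ g hΛ hfin hvol h2 k x
  calc P {ω | BadAt G Λ g ω k x} ≤ P (⋃ f ∈ F, {ω | ∀ v ∈ f, ω v = false}) := by
        refine measure_mono fun ω hω => ?_
        obtain ⟨f, hf, h⟩ := hF3 ω hω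
        exact Set.mem_biUnion (x := f) hf h
    _ ≤ ∑ f ∈ F, P {ω | ∀ v ∈ f, ω v = false} := measure_biUnion_finset_le _ _
    _ = ∑ f ∈ F, ENNReal.ofReal ((1 - p) ^ ((2 * g) ^ k)) := by
        refine Finset.sum_congr rfl fun f hf => ?_
        have := hP f (fun _ => false)
        rw [this]
        simp [(hF2 f hf).1]
    _ = (F.card : ENNReal) * ENNReal.ofReal ((1 - p) ^ ((2 * g) ^ k)) := by simp
    _ ≤ _ := by gcongr

lemma cluster_eq (G : SimpleGraph V) (ω : V → Bool) (x : V) (hx : ω x = true) :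
    openCluster G ω x = {y | Rch G {v | ω v = true} x y} := by
  ext y
  constructor
  · rintro ⟨_, p, hp⟩
    exact ⟨p, hp⟩
  · rintro ⟨p, hp⟩
    exact ⟨hx, p, hp⟩

lemma main_bound {G : SimpleGraph V} (hG : G.Connected) (hV : Infinite V)
    (c d e Λ g Q h : ℕ) (ci β : ℝ)
    (hc : 1 ≤ c) (hd : 1 ≤ d) (hΛ : 1 ≤ Λ) (hg : 1 ≤ g) (hci : 0 < ci) (hβ : 0 ≤ β)
    (hcQ : c ≤ Q) (h2Q : 2 ≤ Q)
    (hh : h = e * g + 1 + (1 + g) * d + 2 * g)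
    (hfin : ∀ (x : V) (r : ℕ), {y | G.dist x y ≤ r}.Finite)
    (hvol : ∀ (x : V) (r : ℕ), 1 ≤ r → {y | G.dist x y ≤ r}.ncard ≤ c * r ^ d)
    (hiso : ∀ (v : V) (L : ℕ), 1 ≤ L → ∀ A : Set V, A ⊆ {y | G.dist v y ≤ L} →
      2 * A.ncard ≤ {y | G.dist v y ≤ L}.ncard →
      ci * (A.ncard : ℝ) ^ β ≤ ((relBoundary G A {y | G.dist v y ≤ L}).ncard : ℝ))
    (hscale : ∀ k : ℕ, (2 * g : ℝ) * (c * (4 * (Λ : ℝ) ^ (g ^ k)) ^ d) * c ≤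
      ci * ((Λ ^ (g ^ (k + 1)) : ℕ) : ℝ) ^ β)
    (h2 : ∀ k, 2 * Λ ^ (g ^ k) ≤ Λ ^ (g ^ (k + 1)))
    (hQ : ∀ k, c * (Λ ^ (g ^ k)) ^ d ≤ Q ^ (g ^ k))
    (P : Measure (V → Bool)) (p : ℝ) (hP : IsBernoulli P p) (hp1 : p ≤ 1)
    (hq : (Q : ℝ) ^ h * (1 - p) ≤ 1 / 2) (K n : ℕ)
    (hn : c * (Λ ^ (g ^ K)) ^ d ≤ n) (x : V) :
    ((n ^ e : ℕ) : ENNReal) * P {ω | (openCluster G ω x).Finite ∧ n < (openCluster G ω x).ncard}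
      ≤ ENNReal.ofReal (2 * (1 / 2) ^ K) := by
  classical
  have hmono : ∀ k, Λ ^ (g ^ k) ≤ Λ ^ (g ^ (k + 1)) := fun k => by have := h2 k; omega
  set W : ℕ → ℕ := fun k => c * (Λ ^ (g ^ k)) ^ d with hW
  have hWk : ∀ k, k ≤ W k := by
    intro k
    have h1 : k ≤ Λ ^ (g ^ k) := by
      induction k with
      | zero => simp
      | succ k ih =>
        have := h2 k
        have : 1 ≤ Λ ^ (g ^ k) := Nat.one_le_pow _ _ hΛ
        omega
    calc k ≤ Λ ^ (g ^ k) := h1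
      _ ≤ (Λ ^ (g ^ k)) ^ d := Nat.le_self_pow (by omega) _
      _ ≤ c * (Λ ^ (g ^ k)) ^ d := Nat.le_mul_of_pos_left _ hc
  let F : ℕ → Set (V → Bool) := fun i => {ω | n < W (K + i + 1) ∧
    ∃ v ∈ (hfin x (W (K + i + 1) + 1)).toFinset, BadAt G Λ g ω (K + i) v}
  have hsub : {ω | (openCluster G ω x).Finite ∧ n < (openCluster G ω x).ncard} ⊆ ⋃ i, F i := by
    rintro ω ⟨hfinC, hnC⟩
    have hx : ω x = true := by
      by_contra hx
      have : openCluster G ω x = ∅ := by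
        ext y; simp [openCluster, hx]
      simp [this] at hnC
    rw [cluster_eq G ω x hx] at hfinC hnC
    set N := {y | Rch G {v | ω v = true} x y}.ncard with hN
    have hex : ∃ i, N ≤ W (K + i + 1) := ⟨N, by have := hWk (K + N + 1); omega⟩
    obtain ⟨i, hi1, hi2⟩ : ∃ i, N ≤ W (K + i + 1) ∧ W (K + i) < N := by
      refine ⟨Nat.find hex, Nat.find_spec hex, ?_⟩
      rcases Nat.eq_zero_or_pos (Nat.find hex) with h0 | h0
      · rw [h0]
        exact lt_of_le_of_lt hn hnC
      · have := Nat.find_min hex (m := Nat.find hex - 1) (by omega)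
        rw [not_le] at this
        have h3 : K + (Nat.find hex - 1) + 1 = K + Nat.find hex := by omega
        rwa [h3] at this
    obtain ⟨U, hU, hU', hcl, v, hv, hvw, hdist⟩ := cluster_geom hG hV hfin {v | ω v = true} x hx
      hfinC (Λ ^ (g ^ (K + i))) (fun v => lt_of_le_of_lt
        (hvol v _ (Nat.one_le_pow _ _ hΛ)) hi2)
    refine Set.mem_iUnion.2 ⟨i, lt_of_lt_of_le hnC hi1, v, ?_, ?_⟩
    · rw [Set.Finite.mem_toFinset]
      show G.dist x v ≤ _
      omega
    · refine bad_of_boundary hG c d Λ g ci β hc hΛ hci hβ hfin hvol hiso hscale hmono ω U (K + i)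
        hU hU' ?_ (K + i) le_rfl v hv hvw
      intro a ha b hb hab
      have := hcl a ha b hb hab
      simpa using this
  have hterm : ∀ i, ((n ^ e : ℕ) : ENNReal) * P (F i) ≤ ENNReal.ofReal ((1 / 2) ^ (K + i)) := by
    intro i
    by_cases hni : n < W (K + i + 1)
    swap
    · have : F i = ∅ := by
        ext ω; simp [F, hni]
      simp [this]
    set k := K + i with hk
    set M := (2 * g) ^ k with hM
    set S := (hfin x (W (k + 1) + 1)).toFinset with hS
    have hScard : S.card ≤ c * (W (k + 1) + 1) ^ d := by
      rw [hS, ← Set.ncard_eq_toFinset_card _ (hfin x _)]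
      exact hvol x _ (by omega)
    have hPF : P (F i) ≤ (S.card : ENNReal) *
        ((NN c d Λ g k : ENNReal) * ENNReal.ofReal ((1 - p) ^ M)) := by
      calc P (F i) ≤ P (⋃ v ∈ S, {ω | BadAt G Λ g ω k v}) := by
            refine measure_mono ?_
            rintro ω ⟨_, v, hv, hb⟩
            exact Set.mem_biUnion (x := v) hv hb
        _ ≤ ∑ v ∈ S, P {ω | BadAt G Λ g ω k v} := measure_biUnion_finset_le _ _
        _ ≤ ∑ v ∈ S, ((NN c d Λ g k : ENNReal) * ENNReal.ofReal ((1 - p) ^ M)) :=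
            Finset.sum_le_sum fun v _ => bad_prob hG c d Λ g hΛ hfin hvol h2 P p hP k v
        _ = _ := by simp
    have hQpos : 1 ≤ Q := by omega
    have hgM : g ^ (k + 1) ≤ g * M := by
      rw [pow_succ, mul_comm]
      exact Nat.mul_le_mul_left _ (Nat.pow_le_pow_left (by omega) _)
    have hM1 : 1 ≤ M := Nat.one_le_pow _ _ (by omega)
    have hkM : k ≤ M := (Nat.lt_pow_self (n := k) (a := 2 * g) (by omega)).le
    have hWQ : W (k + 1) ≤ Q ^ (g * M) :=
      (hQ (k + 1)).trans (Nat.pow_le_pow_right hQpos hgM)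
    have hNN : NN c d Λ g k ≤ Q ^ (2 * g * M) :=
      (Nat.le_mul_of_pos_right _ (Nat.pow_pos hQpos)).trans (NN_bound c d Λ g Q hQ k)
    have hQM : Q ≤ Q ^ M := Nat.le_self_pow (by omega) _
    have hW1 : W (k + 1) + 1 ≤ Q ^ M * Q ^ (g * M) := by
      have : 1 ≤ Q ^ (g * M) := Nat.one_le_pow _ _ hQpos
      nlinarith
    have hnat : n ^ e * (S.card * NN c d Λ g k) ≤ Q ^ (h * M) := by
      calc n ^ e * (S.card * NN c d Λ g k)
          ≤ (Q ^ (g * M)) ^ e * ((Q ^ M * (Q ^ M * Q ^ (g * M)) ^ d) * Q ^ (2 * g * M)) := by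
            refine Nat.mul_le_mul (Nat.pow_le_pow_left (hni.le.trans hWQ) _)
              (Nat.mul_le_mul (hScard.trans (Nat.mul_le_mul (hcQ.trans hQM)
                (Nat.pow_le_pow_left hW1 _))) hNN)
        _ = Q ^ (h * M) := by
            rw [hh, ← pow_add, ← pow_mul, ← pow_mul, ← pow_add, ← pow_add, ← pow_add]
            congr 1
            ring
    have hq0 : 0 ≤ 1 - p := by linarith
    calc ((n ^ e : ℕ) : ENNReal) * P (F i)
        ≤ ((n ^ e : ℕ) : ENNReal) * ((S.card : ENNReal) *
        ((NN c d Λ g k : ENNReal) * ENNReal.ofReal ((1 - p) ^ M))) := by gcongr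
      _ = ((n ^ e * (S.card * NN c d Λ g k) : ℕ) : ENNReal) * ENNReal.ofReal ((1 - p) ^ M) := by
          push_cast; ring
      _ ≤ ((Q ^ (h * M) : ℕ) : ENNReal) * ENNReal.ofReal ((1 - p) ^ M) := by gcongr
      _ = ENNReal.ofReal (((Q : ℝ) ^ h * (1 - p)) ^ M) := by
          rw [← ENNReal.ofReal_natCast, ← ENNReal.ofReal_mul (by positivity), mul_pow, ← pow_mul]
          push_cast
          rfl
      _ ≤ ENNReal.ofReal ((1 / 2) ^ k) := by
          refine ENNReal.ofReal_le_ofReal ?_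
          calc ((Q : ℝ) ^ h * (1 - p)) ^ M ≤ (1 / 2) ^ M := by gcongr
            _ ≤ (1 / 2) ^ k := pow_le_pow_of_le_one (by norm_num) (by norm_num) hkM
  have hs : HasSum (fun i : ℕ => (1 / 2 : ℝ) ^ (K + i)) (2 * (1 / 2) ^ K) := by
    have := hasSum_geometric_two.mul_left ((1 / 2 : ℝ) ^ K)
    rw [mul_comm 2]
    simpa only [pow_add] using this
  calc _ ≤ ((n ^ e : ℕ) : ENNReal) * P (⋃ i, F i) := by gcongr
    _ ≤ ((n ^ e : ℕ) : ENNReal) * ∑' i, P (F i) := by gcongr; exact measure_iUnion_le _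
    _ = ∑' i, ((n ^ e : ℕ) : ENNReal) * P (F i) := ENNReal.tsum_mul_left.symm
    _ ≤ ∑' i, ENNReal.ofReal ((1 / 2) ^ (K + i)) := ENNReal.tsum_le_tsum hterm
    _ = ENNReal.ofReal (2 * (1 / 2) ^ K) := by
        rw [← hs.tsum_eq, ENNReal.ofReal_tsum_of_nonneg (fun i => by positivity) hs.summable]

lemma gball_nat {G : SimpleGraph V} (hG : G.Connected) (x : V) (r : ℕ) :
    gball G x (r : ℝ) = {y | G.dist x y ≤ r} := by
  ext y
  constructor
  · rintro ⟨p, hp⟩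
    have : p.length ≤ r := by exact_mod_cast hp
    exact (SimpleGraph.dist_le p).trans this
  · intro hy
    obtain ⟨p, hp⟩ := hG.exists_walk_length_eq_dist x y
    refine ⟨p, ?_⟩
    have : p.length ≤ r := by rw [hp]; exact hy
    exact_mod_cast this

/-- for all `dᵢ > 1, cᵢ > 0, dᵤ > 1, cᵤ > 0` and `χ > 0` there exists
`p⋆ < 1` such that, on any infinite connected locally finite graph with `L(dᵢ,cᵢ)` and
`𝒱ᵤ(dᵤ,cᵤ)`, for any `p⋆ < p ≤ 1`, under the Bernoulli measure `P_p` one has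
`n^χ · sup_x P_p[n < |C_x| < ∞] → 0`. -/
theorem statement2 :
    ∀ (di ci du cu χ : ℝ), 1 < di → 0 < ci → 1 < du → 0 < cu → 0 < χ →
    ∃ pstar : ℝ, pstar < 1 ∧
      ∀ (V : Type u) (G : SimpleGraph V), Infinite V → G.Connected →
        (∀ v : V, (G.neighborSet v).Finite) →
        LocalIso G di ci → VolUpper G du cu →
        ∀ p : ℝ, pstar < p → p ≤ 1 →
          ∀ P : Measure (V → Bool), IsProbabilityMeasure P → IsBernoulli P p →
            Tendsto (fun n : ℕ => (n : ℝ) ^ χ *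
              ⨆ x : V, (P {ω | (openCluster G ω x).Finite ∧
                n < (openCluster G ω x).ncard}).toReal) atTop (nhds 0) := by
  intro di ci du cu χ hdi hci hdu hcu hχ
  set β : ℝ := (di - 1) / di with hβdef
  have hβ : 0 < β := div_pos (by linarith) (by linarith)
  set c : ℕ := ⌈cu⌉₊ + 1 with hc
  set d : ℕ := ⌈du⌉₊ with hd
  set e : ℕ := ⌈χ⌉₊ with he
  set g : ℕ := ⌈((d : ℝ) + 1) / β⌉₊ + 2 with hg
  set Λ : ℕ := ⌈(2 * g : ℝ) * (c * 4 ^ d) * c / ci⌉₊ + 2 with hΛ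
  set Q : ℕ := c * Λ ^ d with hQdef
  set h : ℕ := e * g + 1 + (1 + g) * d + 2 * g with hh
  have hc1 : 1 ≤ c := by omega
  have hcu' : cu ≤ c := (Nat.le_ceil cu).trans (by simp [hc])
  have hdu' : du ≤ d := Nat.le_ceil du
  have hd1 : 1 ≤ d := by
    have : (1 : ℝ) < d := by linarith
    exact_mod_cast this.le
  have hΛ2 : 2 ≤ Λ := by omega
  have hg2 : 2 ≤ g := by omega
  have hΛd : 2 ≤ Λ ^ d := hΛ2.trans (Nat.le_self_pow (by omega) _)
  have hcQ : c ≤ Q := Nat.le_mul_of_pos_right _ (by omega)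
  have h2Q : 2 ≤ Q := hΛd.trans (Nat.le_mul_of_pos_left _ hc1)
  have hgβ : (d : ℝ) + 1 ≤ g * β := by
    rw [← div_le_iff₀ hβ]
    refine (Nat.le_ceil _).trans ?_
    simp [hg]
  have hΛci : (2 * g : ℝ) * (c * 4 ^ d) * c ≤ ci * Λ := by
    rw [mul_comm ci, ← div_le_iff₀ hci]
    refine (Nat.le_ceil _).trans ?_
    simp [hΛ]
  have h2 : ∀ k, 2 * Λ ^ (g ^ k) ≤ Λ ^ (g ^ (k + 1)) := by
    intro k
    have h1 : g ^ k + 1 ≤ g ^ (k + 1) := by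
      have : 1 ≤ g ^ k := Nat.one_le_pow _ _ (by omega)
      rw [pow_succ]
      nlinarith
    calc 2 * Λ ^ (g ^ k) ≤ Λ * Λ ^ (g ^ k) := Nat.mul_le_mul_right _ hΛ2
      _ = Λ ^ (g ^ k + 1) := by ring
      _ ≤ _ := Nat.pow_le_pow_right (by omega) h1
  have hQ : ∀ k, c * (Λ ^ (g ^ k)) ^ d ≤ Q ^ (g ^ k) := by
    intro k
    rw [hQdef, mul_pow, ← pow_mul, ← pow_mul, mul_comm d]
    exact Nat.mul_le_mul_right _ (Nat.le_self_pow (Nat.pow_pos (by omega)).ne' _)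
  have hscale : ∀ k : ℕ, (2 * g : ℝ) * (c * (4 * (Λ : ℝ) ^ (g ^ k)) ^ d) * c ≤
      ci * ((Λ ^ (g ^ (k + 1)) : ℕ) : ℝ) ^ β := by
    intro k
    have hΛr : (1 : ℝ) ≤ Λ := by exact_mod_cast (by omega : 1 ≤ Λ)
    have h0 : (Λ : ℝ) ≤ (Λ : ℝ) ^ (g ^ k) :=
      le_self_pow₀ hΛr (Nat.pow_pos (by omega)).ne'
    have h1 : ((Λ : ℝ) ^ (g ^ k)) ^ d * (Λ : ℝ) ^ (g ^ k) ≤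
        ((Λ ^ (g ^ (k + 1)) : ℕ) : ℝ) ^ β := by
      push_cast
      rw [← pow_succ, ← pow_mul, ← Real.rpow_natCast, ← Real.rpow_natCast, ← Real.rpow_mul (by positivity)]
      refine Real.rpow_le_rpow_of_exponent_le hΛr ?_
      push_cast
      have : (0 : ℝ) ≤ (g : ℝ) ^ k := by positivity
      calc (g : ℝ) ^ k * (d + 1) ≤ (g : ℝ) ^ k * (g * β) := by gcongr
        _ = _ := by ring
    calc (2 * g : ℝ) * (c * (4 * (Λ : ℝ) ^ (g ^ k)) ^ d) * c
        = ((2 * g : ℝ) * (c * 4 ^ d) * c) * ((Λ : ℝ) ^ (g ^ k)) ^ d := by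
          rw [mul_pow]; ring
      _ ≤ (ci * Λ) * ((Λ : ℝ) ^ (g ^ k)) ^ d := by gcongr
      _ ≤ (ci * (Λ : ℝ) ^ (g ^ k)) * ((Λ : ℝ) ^ (g ^ k)) ^ d := by gcongr
      _ = ci * (((Λ : ℝ) ^ (g ^ k)) ^ d * (Λ : ℝ) ^ (g ^ k)) := by ring
      _ ≤ _ := by gcongr
  have hQr : (0 : ℝ) < (Q : ℝ) ^ h := by
    have : (0 : ℝ) < Q := by exact_mod_cast (by omega : 0 < Q)
    positivity
  refine ⟨1 - 1 / (2 * (Q : ℝ) ^ h), by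
    have : 0 < 1 / (2 * (Q : ℝ) ^ h) := by positivity
    linarith, ?_⟩
  intro V G hV hG _ hiso hvol p hp hp1 P hPp hP
  have hq : (Q : ℝ) ^ h * (1 - p) ≤ 1 / 2 := by
    have h1 : 1 - p ≤ 1 / (2 * (Q : ℝ) ^ h) := by linarith
    calc (Q : ℝ) ^ h * (1 - p) ≤ (Q : ℝ) ^ h * (1 / (2 * (Q : ℝ) ^ h)) := by gcongr
      _ = 1 / 2 := by field_simp
  have hfin1 : ∀ (x : V) (r : ℕ), 1 ≤ r → {y | G.dist x y ≤ r}.Finite := by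
    intro x r hr
    have := (hvol x r (by exact_mod_cast hr)).1
    rwa [gball_nat hG] at this
  have hfin : ∀ (x : V) (r : ℕ), {y | G.dist x y ≤ r}.Finite := by
    intro x r
    refine (hfin1 x (r + 1) (by omega)).subset fun y hy => ?_
    exact le_trans (show G.dist x y ≤ r from hy) (by omega)
  have hvol' : ∀ (x : V) (r : ℕ), 1 ≤ r → {y | G.dist x y ≤ r}.ncard ≤ c * r ^ d := by
    intro x r hr
    have hr' : (1 : ℝ) ≤ r := by exact_mod_cast hr
    have h1 := (hvol x r hr').2
    rw [gball_nat hG] at h1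
    have h3 : cu * (r : ℝ) ^ du ≤ c * (r : ℝ) ^ d := by
      rw [← Real.rpow_natCast (r : ℝ) d]
      gcongr
    exact_mod_cast h1.trans h3
  have hiso' : ∀ (v : V) (L : ℕ), 1 ≤ L → ∀ A : Set V, A ⊆ {y | G.dist v y ≤ L} →
      2 * A.ncard ≤ {y | G.dist v y ≤ L}.ncard →
      ci * (A.ncard : ℝ) ^ β ≤ ((relBoundary G A {y | G.dist v y ≤ L}).ncard : ℝ) := by
    intro v L hL A hA hcard
    have h1 := hiso v L (by exact_mod_cast hL) A
    rw [gball_nat hG] at h1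
    refine h1 hA ?_
    have : (2 : ℝ) * A.ncard ≤ ({y | G.dist v y ≤ L}.ncard : ℝ) := by exact_mod_cast hcard
    linarith
  have hbound : ∀ K n : ℕ, c * (Λ ^ (g ^ K)) ^ d ≤ n →
      (n : ℝ) ^ χ * (⨆ x : V, (P {ω | (openCluster G ω x).Finite ∧
        n < (openCluster G ω x).ncard}).toReal) ≤ 2 * (1 / 2) ^ K := by
    intro K n hn
    have hn1 : 1 ≤ n := by
      refine le_trans ?_ hn
      exact Nat.mul_pos hc1 (Nat.pow_pos (Nat.pow_pos (by omega)))
    have hnr : (1 : ℝ) ≤ n := by exact_mod_cast hn1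
    have hpos : 0 < (n : ℝ) ^ χ := by positivity
    have hle : (n : ℝ) ^ χ ≤ (n : ℝ) ^ e := by
      rw [← Real.rpow_natCast]
      exact Real.rpow_le_rpow_of_exponent_le hnr (Nat.le_ceil χ)
    haveI : Nonempty V := inferInstance
    rw [mul_comm, ← le_div_iff₀ hpos]
    refine ciSup_le fun x => ?_
    rw [le_div_iff₀ hpos]
    have hmb := main_bound hG hV c d e Λ g Q h ci β hc1 hd1 (by omega) (by omega) hci hβ.le hcQ h2Q
      hh hfin hvol' hiso' hscale h2 hQ P p hP hp1 hq K n hn x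
    have h3 := ENNReal.toReal_mono ENNReal.ofReal_ne_top hmb
    rw [ENNReal.toReal_mul, ENNReal.toReal_ofReal (by positivity), ENNReal.toReal_natCast] at h3
    push_cast at h3
    refine le_trans ?_ h3
    rw [mul_comm]
    gcongr
  rw [Metric.tendsto_atTop]
  intro ε hε
  obtain ⟨K, hK⟩ := exists_pow_lt_of_lt_one (show (0 : ℝ) < ε / 2 by linarith)
    (show (1 / 2 : ℝ) < 1 by norm_num)
  refine ⟨c * (Λ ^ (g ^ K)) ^ d, fun n hn => ?_⟩
  have h0 : 0 ≤ (n : ℝ) ^ χ * (⨆ x : V, (P {ω | (openCluster G ω x).Finite ∧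
        n < (openCluster G ω x).ncard}).toReal) :=
    mul_nonneg (by positivity) (Real.iSup_nonneg fun x => ENNReal.toReal_nonneg)
  rw [Real.dist_eq, sub_zero, abs_of_nonneg h0]
  exact (hbound K n hn).trans_lt (by linarith)
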